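/- Write R = ℤ_p[[S,T]], and for a, b ∈ ℤ_p not both divisible by p write R_{a,b} = R/((1+S)^a·(1+T)^b − 1) with quotient map π_{a,b} : R → R_{a,b}; let U_{a,b} ∈ R_{a,b} be π_{a,b}(S) if p does not divide b, and π_{a,b}(T) otherwise. Suppose g ∈ R is such that for all pairs (a,b) of elements of ℤ_p not both divisible by p, π_{a,b}(g) divides U_{a,b} in R_{a,b}. Then g is a unit in R. -/

import Mathlib

open PowerSeries
open scoped Classical

/-- The `p`-adic binomial coefficient `C(a,n) = (1/n!) ∏_{i=0}^{n-1} (a - i) ∈ ℚ_p`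
for `a ∈ ℤ_p`. -/
noncomputable def padicBinom (p : ℕ) [Fact p.Prime] (a : ℤ_[p]) (n : ℕ) : ℚ_[p] :=
  (n.factorial : ℚ_[p])⁻¹ * ∏ i ∈ Finset.range n, ((a : ℚ_[p]) - i)

theorem exists_padicInt_padicBinom (p : ℕ) [Fact p.Prime] (a : ℤ_[p]) :
    ∃ f : ℕ → ℤ_[p], ∀ n, ((f n : ℚ_[p])) = padicBinom p a n := by
  refine ⟨fun n => Ring.choose a n, fun n => ?_⟩
  have h := Ring.descPochhammer_eq_factorial_smul_choose a n
  rw [← Polynomial.aeval_eq_smeval, Polynomial.aeval_def, ← Polynomial.eval_map,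
    descPochhammer_map, descPochhammer_eval_eq_prod_range, nsmul_eq_mul] at h
  have hn : (n.factorial : ℚ_[p]) ≠ 0 := Nat.cast_ne_zero.mpr n.factorial_ne_zero
  have h' := congrArg (PadicInt.Coe.ringHom (p := p)) h
  simp only [map_prod, map_sub, map_mul, map_natCast] at h'
  rw [padicBinom, eq_inv_mul_iff_mul_eq₀ hn]
  exact h'.symm

theorem padicBinom_zero (p : ℕ) [Fact p.Prime] (a : ℤ_[p]) : padicBinom p a 0 = 1 := by
  simp [padicBinom]

theorem padicBinom_one (p : ℕ) [Fact p.Prime] (a : ℤ_[p]) : padicBinom p a 1 = a := by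
  simp [padicBinom]

section

variable {A : Type*} [CommRing A] (f g : PowerSeries (PowerSeries A))

theorem coeff_zero_coeff_zero_mul :
    coeff 0 (coeff 0 (f * g)) = coeff 0 (coeff 0 f) * coeff 0 (coeff 0 g) := by
  simp

theorem coeff_one_coeff_zero_mul :
    coeff 1 (coeff 0 (f * g)) = coeff 0 (coeff 0 f) * coeff 1 (coeff 0 g) +
      coeff 1 (coeff 0 f) * coeff 0 (coeff 0 g) := by
  simp [coeff_mul, Finset.Nat.antidiagonal_succ]

theorem coeff_zero_coeff_one_mul :
    coeff 0 (coeff 1 (f * g)) = coeff 0 (coeff 0 f) * coeff 0 (coeff 1 g) +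
      coeff 0 (coeff 1 f) * coeff 0 (coeff 0 g) := by
  simp [coeff_mul, Finset.Nat.antidiagonal_succ]

end

/-- Coefficients of degree at most one of a relation `U = g * q` modulo
`(1 + S)^a * (1 + T)^b - 1`. -/
theorem exists_coeff_relations {A : Type*} [CommRing A] {g U : PowerSeries (PowerSeries A)}
    {ga gb : ℕ → A} (ha : ga 0 = 1) (hb : gb 0 = 1)
    (h : Ideal.Quotient.mk (Ideal.span
        {(C (R := PowerSeries A) (mk ga)) * (mk fun n => C (R := A) (gb n)) - 1}) g ∣
      Ideal.Quotient.mk (Ideal.span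
        {(C (R := PowerSeries A) (mk ga)) * (mk fun n => C (R := A) (gb n)) - 1}) U) :
    ∃ q₀ q₁ q₂ r : A,
      coeff 0 (coeff 0 U) = coeff 0 (coeff 0 g) * q₀ ∧
      coeff 1 (coeff 0 U) = coeff 0 (coeff 0 g) * q₁ + coeff 1 (coeff 0 g) * q₀ + ga 1 * r ∧
      coeff 0 (coeff 1 U) = coeff 0 (coeff 0 g) * q₂ + coeff 0 (coeff 1 g) * q₀ + gb 1 * r := by
  obtain ⟨q', hq'⟩ := h
  obtain ⟨q, rfl⟩ := Ideal.Quotient.mk_surjective q'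
  rw [← map_mul, Ideal.Quotient.eq, Ideal.mem_span_singleton] at hq'
  obtain ⟨r, hr⟩ := hq'
  rw [sub_eq_iff_eq_add'] at hr
  have h00 : coeff 0 (coeff 0 ((C (R := PowerSeries A) (mk ga)) *
      (mk fun n => C (R := A) (gb n)) - 1)) = 0 := by
    rw [map_sub, map_sub, coeff_zero_coeff_zero_mul]
    simp [ha, hb]
  have h10 : coeff 1 (coeff 0 ((C (R := PowerSeries A) (mk ga)) *
      (mk fun n => C (R := A) (gb n)) - 1)) = ga 1 := by
    rw [map_sub, map_sub, coeff_one_coeff_zero_mul]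
    simp [hb, coeff_C, coeff_one]
  have h01 : coeff 0 (coeff 1 ((C (R := PowerSeries A) (mk ga)) *
      (mk fun n => C (R := A) (gb n)) - 1)) = gb 1 := by
    rw [map_sub, map_sub, coeff_zero_coeff_one_mul]
    simp [ha, coeff_C, coeff_one]
  refine ⟨coeff 0 (coeff 0 q), coeff 1 (coeff 0 q), coeff 0 (coeff 1 q),
    coeff 0 (coeff 0 r), ?_, ?_, ?_⟩
  · rw [hr, map_add, map_add, coeff_zero_coeff_zero_mul, coeff_zero_coeff_zero_mul, h00]
    ring
  · rw [hr, map_add, map_add, coeff_one_coeff_zero_mul, coeff_one_coeff_zero_mul, h00, h10]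
    ring
  · rw [hr, map_add, map_add, coeff_zero_coeff_one_mul, coeff_zero_coeff_one_mul, h00, h01]
    ring

/-- Realize `R = ℤ_p[[S,T]]` as the iterated power series ring
`ℤ_p[[S]][[T]]`.  For `a, b ∈ ℤ_p` not both divisible by `p`, let
`R_{a,b} = R/((1+S)^a (1+T)^b - 1)` with quotient map `π_{a,b}`, and set
`U_{a,b} = π_{a,b}(S)` if `p ∤ b` and `U_{a,b} = π_{a,b}(T)` otherwise, where the binomial
series have coefficients `ga, gb : ℕ → ℤ_p` lifting `C(a,n), C(b,n) ∈ ℚ_p`.  If `g ∈ R` is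
such that `π_{a,b}(g)` divides `U_{a,b}` in `R_{a,b}` for all such pairs `(a,b)`, then `g`
is a unit in `R`. -/
theorem statement8 (p : ℕ) [Fact p.Prime] (hp : Odd p)
    (g : PowerSeries (PowerSeries ℤ_[p]))
    (H : ∀ a b : ℤ_[p], ¬ ((p : ℤ_[p]) ∣ a ∧ (p : ℤ_[p]) ∣ b) →
      ∀ ga gb : ℕ → ℤ_[p],
        (∀ n, ((ga n : ℚ_[p])) = padicBinom p a n) →
        (∀ n, ((gb n : ℚ_[p])) = padicBinom p b n) →
        (Ideal.Quotient.mk (Ideal.span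
            {(PowerSeries.C (R := PowerSeries ℤ_[p]) (PowerSeries.mk ga)) *
              (PowerSeries.mk fun n => PowerSeries.C (R := ℤ_[p]) (gb n)) - 1}) g) ∣
          (Ideal.Quotient.mk (Ideal.span
            {(PowerSeries.C (R := PowerSeries ℤ_[p]) (PowerSeries.mk ga)) *
              (PowerSeries.mk fun n => PowerSeries.C (R := ℤ_[p]) (gb n)) - 1})
            (if (p : ℤ_[p]) ∣ b then (PowerSeries.X : PowerSeries (PowerSeries ℤ_[p]))
              else PowerSeries.C (R := PowerSeries ℤ_[p]) PowerSeries.X))) :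
    IsUnit g := by
  have hunit : ¬ (p : ℤ_[p]) ∣ 1 := fun h => PadicInt.prime_p.not_isUnit (isUnit_of_dvd_one h)
  have key : ∀ a b : ℤ_[p], ¬ ((p : ℤ_[p]) ∣ a ∧ (p : ℤ_[p]) ∣ b) → ∃ q₀ q₁ q₂ r : ℤ_[p],
      coeff 0 (coeff 0 (if (p : ℤ_[p]) ∣ b then (X : PowerSeries (PowerSeries ℤ_[p]))
        else C (R := PowerSeries ℤ_[p]) X)) = coeff 0 (coeff 0 g) * q₀ ∧
      coeff 1 (coeff 0 (if (p : ℤ_[p]) ∣ b then (X : PowerSeries (PowerSeries ℤ_[p]))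
        else C (R := PowerSeries ℤ_[p]) X)) =
          coeff 0 (coeff 0 g) * q₁ + coeff 1 (coeff 0 g) * q₀ + a * r ∧
      coeff 0 (coeff 1 (if (p : ℤ_[p]) ∣ b then (X : PowerSeries (PowerSeries ℤ_[p]))
        else C (R := PowerSeries ℤ_[p]) X)) =
          coeff 0 (coeff 0 g) * q₂ + coeff 0 (coeff 1 g) * q₀ + b * r := by
    intro a b hab
    obtain ⟨ga, hga⟩ := exists_padicInt_padicBinom p a
    obtain ⟨gb, hgb⟩ := exists_padicInt_padicBinom p b
    have ha0 : ga 0 = 1 := Subtype.ext ((hga 0).trans (padicBinom_zero p a))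
    have hb0 : gb 0 = 1 := Subtype.ext ((hgb 0).trans (padicBinom_zero p b))
    have ha1 : ga 1 = a := Subtype.ext ((hga 1).trans (padicBinom_one p a))
    have hb1 : gb 1 = b := Subtype.ext ((hgb 1).trans (padicBinom_one p b))
    have := exists_coeff_relations ha0 hb0 (H a b hab ga gb hga hgb)
    rw [ha1, hb1] at this
    exact this
  rw [isUnit_iff_constantCoeff, isUnit_iff_constantCoeff,
    ← coeff_zero_eq_constantCoeff_apply, ← coeff_zero_eq_constantCoeff_apply]
  by_contra hg
  generalize coeff 0 (coeff 0 g) = γ at key hg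
  generalize coeff 1 (coeff 0 g) = α at key
  generalize coeff 0 (coeff 1 g) = β at key
  -- Along `b = 1`: the constant term of `g` vanishes and `α - a β` is always a unit.
  have key_one : ∀ a : ℤ_[p], γ = 0 ∧ IsUnit (α - a * β) := by
    intro a
    obtain ⟨q₀, q₁, q₂, r, h0, h1, h2⟩ := key a 1 (fun h => hunit h.2)
    rw [if_neg hunit] at h0 h1 h2
    simp [coeff_C] at h0 h1 h2
    have hγ : γ = 0 := by
      rcases h0 with h | h
      · exact h
      · refine absurd (IsUnit.of_mul_eq_one (q₁ - a * q₂) ?_) hg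
        linear_combination -h1 + a * h2 + (α - a * β) * -h
    refine ⟨hγ, IsUnit.of_mul_eq_one q₀ ?_⟩
    linear_combination -h1 + a * h2 - (q₁ - a * q₂) * hγ
  have hγ := (key_one 0).1
  obtain ⟨q₀, q₁, q₂, r, -, -, h2⟩ := key 1 0 (fun h => hunit h.1)
  rw [if_pos (dvd_zero _)] at h2
  simp [hγ] at h2
  have hu := (key_one (α * q₀)).2
  rw [show α - α * q₀ * β = 0 by linear_combination α * h2] at hu
  exact not_isUnit_zero hu
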